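/- arXiv:1307.2743 — 3 statements merged into one kernel-verified Lean document; each statement's English description precedes it below -/
import Mathlib

section
/- Let D be a commutative dga over ℤ_p whose homology and Massey products agree with those of C, with chosen order-p classes α_m as in that definition. Suppose a ∈ D_{2p-3} and b ∈ D_{2p-2} satisfy d(a) = 0, α_1 = [-a], and d(b) = p·a. Then for every integer i ≥ 1: d(b^i) = i·p·a·b^{i-1}; the element a·b^{i-1} is a cycle; α_i = [-i·a·b^{i-1}] in H_{(2p-2)i-1}(D); and the homology class [a·b^{i-1}] generates the cyclic ℤ_p-module H_{(2p-2)i-1}(D) ≅ ℤ_p/ipℤ_p. -/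
set_option synthInstance.maxHeartbeats 1000000
set_option maxHeartbeats 1000000

/-!
Statement 12: the nonnegative part of the main computation.
-/

noncomputable section

/-- A (graded-commutative) differential graded algebra over the `p`-adic integers,
presented via an internal grading: a `ℤ_[p]`-algebra `A` together with a family of
submodules `grading n` (`n : ℤ`) forming an internal direct sum decomposition
`A = ⊕ₙ Aₙ`, compatible with the multiplication, graded-commutative, and equipped
with a square-zero differential of degree `-1` satisfying the graded Leibniz rule. -/
structure DGA (p : ℕ) [Fact p.Prime] where
  A : Type
  [ringA : Ring A]
  [algA : Algebra ℤ_[p] A]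
  grading : ℤ → Submodule ℤ_[p] A
  one_mem : (1 : A) ∈ grading 0
  mul_mem : ∀ {i j : ℤ} {a b : A}, a ∈ grading i → b ∈ grading j → a * b ∈ grading (i + j)
  isInternal : DirectSum.IsInternal grading
  comm : ∀ {i j : ℤ} {a b : A}, a ∈ grading i → b ∈ grading j →
    a * b = (((-1 : ℤˣ) ^ (i * j) : ℤˣ) : ℤ) • (b * a)
  d : A →ₗ[ℤ_[p]] A
  d_mem : ∀ {n : ℤ} {a : A}, a ∈ grading n → d a ∈ grading (n - 1)
  d_sq : ∀ a : A, d (d a) = 0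
  leibniz : ∀ {i : ℤ} {a : A}, a ∈ grading i → ∀ b : A,
    d (a * b) = d a * b + (((-1 : ℤˣ) ^ i : ℤˣ) : ℤ) • (a * d b)

attribute [instance] DGA.ringA DGA.algA

namespace DGA

variable {p : ℕ} [Fact p.Prime]

/-- The `n`-cycles of a dga: elements of degree `n` killed by the differential. -/
def cycles (X : DGA p) (n : ℤ) : Submodule ℤ_[p] X.A :=
  X.grading n ⊓ LinearMap.ker X.d

/-- The `n`-boundaries of a dga: images under `d` of elements of degree `n + 1`. -/
def boundaries (X : DGA p) (n : ℤ) : Submodule ℤ_[p] X.A :=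
  (X.grading (n + 1)).map X.d

/-- The `n`-th homology `H_n = ker(d : A_n → A_(n-1)) / im(d : A_(n+1) → A_n)` of a dga. -/
abbrev H (X : DGA p) (n : ℤ) : Type :=
  X.cycles n ⧸ ((X.boundaries n).comap (X.cycles n).subtype)

/-- The homology class of a cycle. -/
def cls (X : DGA p) {n : ℤ} (a : X.A) (h : a ∈ X.cycles n) : X.H n :=
  Submodule.Quotient.mk ⟨a, h⟩

end DGA

/-- The Massey product relation `⟨α_i, p, α_j⟩ = {α_(i+j)}` (with zero indeterminacy)
inside a dga `D`, for a family of homology classes `α_m ∈ H_((2p-2)m-1)(D)`: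
for all cycles `a`, `c` representing `α_i`, `α_j`, there exist `u ∈ D_((2p-2)i)` with
`d(u) = p·a` and `v ∈ D_((2p-2)j)` with `d(v) = -p·c`, and for all such `u`, `v` the
element `-u·c + a·v` is a cycle representing `α_(i+j)`. -/
def MasseyRel (p : ℕ) [Fact p.Prime] (D : DGA p)
    (α : (m : ℤ) → D.H ((2 * (p : ℤ) - 2) * m - 1)) (i j : ℤ) : Prop :=
  ∀ (a : D.A) (ha : a ∈ D.cycles ((2 * (p : ℤ) - 2) * i - 1)), D.cls a ha = α i →
  ∀ (c : D.A) (hc : c ∈ D.cycles ((2 * (p : ℤ) - 2) * j - 1)), D.cls c hc = α j →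
    (∃ u ∈ D.grading ((2 * (p : ℤ) - 2) * i), D.d u = (p : ℤ_[p]) • a) ∧
    (∃ v ∈ D.grading ((2 * (p : ℤ) - 2) * j), D.d v = -((p : ℤ_[p]) • c)) ∧
    (∀ u ∈ D.grading ((2 * (p : ℤ) - 2) * i), ∀ v ∈ D.grading ((2 * (p : ℤ) - 2) * j),
      D.d u = (p : ℤ_[p]) • a → D.d v = -((p : ℤ_[p]) • c) →
      ∃ h : -(u * c) + a * v ∈ D.cycles ((2 * (p : ℤ) - 2) * (i + j) - 1),
        D.cls _ h = α (i + j))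

/-- The homology of `D` agrees with that of `C` (equivalently, with `π_*` of the
`K(1)`-local sphere): `H_0 ≅ ℤ_p`, `H_(-1) ≅ ℤ_p`, `H_((2p-2)m-1) ≅ ℤ_p/mpℤ_p` for
`m ≠ 0`, and all other homology groups vanish. -/
def HomologyAgreesWithC (p : ℕ) [Fact p.Prime] (D : DGA p) : Prop :=
  Nonempty (D.H 0 ≃ₗ[ℤ_[p]] ℤ_[p]) ∧
  Nonempty (D.H (-1) ≃ₗ[ℤ_[p]] ℤ_[p]) ∧
  (∀ m : ℤ, m ≠ 0 →
    Nonempty (D.H ((2 * (p : ℤ) - 2) * m - 1) ≃ₗ[ℤ_[p]]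
      (ℤ_[p] ⧸ Ideal.span {(m : ℤ_[p]) * (p : ℤ_[p])}))) ∧
  (∀ n : ℤ, n ≠ 0 → (¬ ∃ m : ℤ, n = (2 * (p : ℤ) - 2) * m - 1) → Subsingleton (D.H n))

/-- The Massey products of `D` agree with those of `C` (equivalently, with the Toda
brackets of the `K(1)`-local sphere): there are classes `α_m ∈ H_((2p-2)m-1)(D)` of
additive order exactly `p` (for `m ≠ 0`, with `α_0 = 0`) satisfying
`⟨α_i, p, α_j⟩ = {α_(i+j)}` for all nonzero `i`, `j`. -/
def MasseyAgreesWithC (p : ℕ) [Fact p.Prime] (D : DGA p) : Prop :=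
  ∃ α : (m : ℤ) → D.H ((2 * (p : ℤ) - 2) * m - 1),
    α 0 = 0 ∧
    (∀ m : ℤ, m ≠ 0 → α m ≠ 0 ∧ (p : ℤ_[p]) • α m = 0) ∧
    (∀ i : ℤ, i ≠ 0 → ∀ j : ℤ, j ≠ 0 → MasseyRel p D α i j)

/-- The homology and Massey products of `D` agree with those of `C`. -/
def AgreesWithC (p : ℕ) [Fact p.Prime] (D : DGA p) : Prop :=
  HomologyAgreesWithC p D ∧ MasseyAgreesWithC p D


namespace DGA

variable {p : ℕ} [Fact p.Prime] (D : DGA p)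

theorem commute_of_even {m n : ℤ} {x y : D.A} (hm : Even m) (hx : x ∈ D.grading m)
    (hy : y ∈ D.grading n) : Commute x y := by
  have h := D.comm hx hy
  rw [(hm.mul_right n).neg_one_zpow] at h
  simpa [Commute, SemiconjBy] using h

theorem leibniz_of_even {m : ℤ} {x : D.A} (hm : Even m) (hx : x ∈ D.grading m) (y : D.A) :
    D.d (x * y) = D.d x * y + x * D.d y := by
  have h := D.leibniz hx y
  rw [hm.neg_one_zpow] at h
  simpa using h

theorem pow_mem {m : ℤ} {x : D.A} (hx : x ∈ D.grading m) (k : ℕ) :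
    x ^ k ∈ D.grading (m * k) := by
  induction k with
  | zero => simpa using D.one_mem
  | succ k ih =>
    have h := D.mul_mem ih hx
    rw [← pow_succ] at h
    convert h using 2
    push_cast
    ring

theorem mul_self_of_odd (hp : Odd p) {m : ℤ} {x : D.A} (hm : Odd m)
    (hx : x ∈ D.grading m) : x * x = 0 := by
  have h := D.comm hx hx
  rw [(hm.mul hm).neg_one_zpow] at h
  have h2 : (2 : ℤ_[p]) • (x * x) = 0 := by
    rw [two_smul]
    nth_rewrite 1 [h]
    simp
  have hu : IsUnit (2 : ℤ_[p]) := by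
    by_contra h'
    rw [PadicInt.not_isUnit_iff] at h'
    have hdvd : (p : ℤ) ∣ 2 := (PadicInt.norm_int_lt_one_iff_dvd 2).1 (by exact_mod_cast h')
    have hp2 : p ∣ 2 := by exact_mod_cast hdvd
    rw [(Nat.prime_dvd_prime_iff_eq Fact.out Nat.prime_two).1 hp2] at hp
    exact absurd hp (by decide)
  exact hu.smul_eq_zero.1 h2

/-- If `d b = p a`, with `b` of even degree, then `d (b ^ (k + 1)) = (k + 1) p a b ^ k`. -/
theorem d_pow_succ {m n : ℤ} {a b : D.A} (hm : Even m) (hb : b ∈ D.grading m)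
    (ha : a ∈ D.grading n) {r : ℤ_[p]} (hdb : D.d b = r • a) (k : ℕ) :
    D.d (b ^ (k + 1)) = (((k + 1 : ℕ) : ℤ_[p]) * r) • (a * b ^ k) := by
  induction k with
  | zero => simp [hdb]
  | succ k ih =>
    have hc : b * (a * b ^ k) = a * b ^ (k + 1) := by
      rw [← mul_assoc, (D.commute_of_even hm hb ha).eq, mul_assoc, ← pow_succ']
    rw [pow_succ' b (k + 1), D.leibniz_of_even hm hb, ih, hdb, mul_smul_comm, hc,
      smul_mul_assoc, ← add_smul]
    congr 1
    push_cast
    ring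

theorem d_mul_pow (hp : Odd p) {m n : ℤ} {a b : D.A} (hm : Even m) (hn : Odd n)
    (hb : b ∈ D.grading m) (ha : a ∈ D.grading n) {r : ℤ_[p]} (hda : D.d a = 0)
    (hdb : D.d b = r • a) (k : ℕ) : D.d (a * b ^ k) = 0 := by
  rw [D.leibniz ha, hda, zero_mul, zero_add]
  cases k with
  | zero =>
    have h := D.leibniz D.one_mem 1
    simp at h
    simp [h]
  | succ k =>
    rw [D.d_pow_succ hm hb ha hdb, mul_smul_comm, ← mul_assoc, D.mul_self_of_odd hp hn ha]
    simp

end DGA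

/-- In a cyclic module `ℤ_[p] / (r p)`, an element not annihilated by `r` is a generator. -/
theorem PadicInt.span_singleton_eq_top_of_smul_ne_zero {p : ℕ} [Fact p.Prime] {M : Type*}
    [AddCommGroup M] [Module ℤ_[p] M] {r : ℤ_[p]}
    (e : M ≃ₗ[ℤ_[p]] ℤ_[p] ⧸ Ideal.span {r * (p : ℤ_[p])}) {x : M} (hx : r • x ≠ 0) :
    Submodule.span ℤ_[p] {x} = ⊤ := by
  obtain ⟨y, hy⟩ := Ideal.Quotient.mk_surjective (e x)
  have hu : IsUnit y := by
    by_contra hy'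
    have hdvd : (p : ℤ_[p]) ∣ y := by
      rwa [← PadicInt.norm_lt_one_iff_dvd, ← PadicInt.mem_nonunits]
    apply hx
    apply e.injective
    rw [map_smul, map_zero, ← hy, ← Ideal.Quotient.mk_eq_mk, ← Submodule.Quotient.mk_smul,
      Submodule.Quotient.mk_eq_zero, Ideal.mem_span_singleton, smul_eq_mul]
    exact mul_dvd_mul_left r hdvd
  obtain ⟨u, rfl⟩ := hu
  rw [eq_top_iff]
  intro z _
  obtain ⟨w, hw⟩ := Ideal.Quotient.mk_surjective (e z)
  refine Submodule.mem_span_singleton.2 ⟨w * (↑u⁻¹ : ℤ_[p]), e.injective ?_⟩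
  rw [map_smul, ← hy, ← hw, ← Ideal.Quotient.mk_eq_mk, ← Ideal.Quotient.mk_eq_mk,
    ← Submodule.Quotient.mk_smul, smul_eq_mul, mul_assoc, Units.inv_mul, mul_one]

/-- The nonnegative part of the main computation: with `α_1 = [-a]`, `d(a) = 0` and
`d(b) = p·a`, one has `d(bⁱ) = i·p·a·b^(i-1)`, the element `a·b^(i-1)` is a cycle,
`α_i = [-i·a·b^(i-1)]`, and `[a·b^(i-1)]` generates the cyclic `ℤ_[p]`-module
`H_((2p-2)i-1)(D) ≅ ℤ_p/ipℤ_p`, for every `i ≥ 1`. -/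
theorem nonnegative_part (p : ℕ) [Fact p.Prime] (hp : Odd p) (D : DGA p)
    (hH : HomologyAgreesWithC p D)
    (α : (m : ℤ) → D.H ((2 * (p : ℤ) - 2) * m - 1))
    (hα0 : α 0 = 0)
    (hord : ∀ m : ℤ, m ≠ 0 → α m ≠ 0 ∧ (p : ℤ_[p]) • α m = 0)
    (hrel : ∀ i : ℤ, i ≠ 0 → ∀ j : ℤ, j ≠ 0 → MasseyRel p D α i j)
    (a b : D.A)
    (ha : a ∈ D.grading ((2 * (p : ℤ) - 2) * 1 - 1))
    (hb : b ∈ D.grading ((2 * (p : ℤ) - 2) * 1))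
    (hda : D.d a = 0) (hdb : D.d b = (p : ℤ_[p]) • a)
    (hα1 : ∃ h : -a ∈ D.cycles ((2 * (p : ℤ) - 2) * 1 - 1), D.cls (-a) h = α 1) :
    ∀ i : ℕ, 1 ≤ i →
      D.d (b ^ i) = ((i : ℤ_[p]) * (p : ℤ_[p])) • (a * b ^ (i - 1)) ∧
      ∃ h : a * b ^ (i - 1) ∈ D.cycles ((2 * (p : ℤ) - 2) * (i : ℤ) - 1),
        (∃ h' : (-(i : ℤ_[p])) • (a * b ^ (i - 1))
              ∈ D.cycles ((2 * (p : ℤ) - 2) * (i : ℤ) - 1),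
          D.cls _ h' = α (i : ℤ)) ∧
        Submodule.span ℤ_[p] {D.cls (a * b ^ (i - 1)) h} = ⊤ ∧
        Nonempty (D.H ((2 * (p : ℤ) - 2) * (i : ℤ) - 1) ≃ₗ[ℤ_[p]]
          (ℤ_[p] ⧸ Ideal.span {(i : ℤ_[p]) * (p : ℤ_[p])})) := by
  have hm : Even ((2 * (p : ℤ) - 2) * 1) := ⟨(p : ℤ) - 1, by ring⟩
  have hn : Odd ((2 * (p : ℤ) - 2) * 1 - 1) := hm.sub_odd odd_one
  have hcyc (k : ℕ) :
      a * b ^ k ∈ D.cycles ((2 * (p : ℤ) - 2) * ((k + 1 : ℕ) : ℤ) - 1) := by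
    refine ⟨?_, D.d_mul_pow hp hm hn hb ha hda hdb k⟩
    have hdeg : (2 * (p : ℤ) - 2) * ((k + 1 : ℕ) : ℤ) - 1
        = (2 * (p : ℤ) - 2) * 1 - 1 + (2 * (p : ℤ) - 2) * 1 * k := by
      push_cast
      ring
    rw [hdeg]
    exact D.mul_mem ha (D.pow_mem hb k)
  have hclass (k : ℕ) :
      ∃ h : (-((k + 1 : ℕ) : ℤ_[p])) • (a * b ^ k)
          ∈ D.cycles ((2 * (p : ℤ) - 2) * ((k + 1 : ℕ) : ℤ) - 1),
        D.cls _ h = α ((k + 1 : ℕ) : ℤ) := by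
    induction k with
    | zero => simpa using hα1
    | succ k ih =>
      obtain ⟨h, hk⟩ := ih
      obtain ⟨h1, hk1⟩ := hα1
      have hmassey := (hrel 1 one_ne_zero ((k + 1 : ℕ) : ℤ) (by positivity)
        (-a) h1 hk1 _ h hk).2.2 (-b) (neg_mem hb) (b ^ (k + 1))
        (by simpa using D.pow_mem hb (k + 1)) (by simp [hdb])
        (by rw [D.d_pow_succ hm hb ha hdb, smul_smul, ← neg_smul]; congr 1; ring)
      have hdeg : (1 : ℤ) + ((k + 1 : ℕ) : ℤ) = ((k + 1 + 1 : ℕ) : ℤ) := by push_cast; ring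
      have hval : -(-b * ((-((k + 1 : ℕ) : ℤ_[p])) • (a * b ^ k))) + -a * b ^ (k + 1)
          = (-((k + 1 + 1 : ℕ) : ℤ_[p])) • (a * b ^ (k + 1)) := by
        have hc : b * (a * b ^ k) = a * b ^ (k + 1) := by
          rw [← mul_assoc, (D.commute_of_even hm hb ha).eq, mul_assoc, ← pow_succ']
        rw [neg_mul, neg_neg, mul_smul_comm, hc, neg_mul]
        push_cast
        module
      rw [hdeg] at hmassey
      simpa only [hval] using hmassey
  rintro (_ | k) hi
  · omega
  obtain ⟨e⟩ := hH.2.2.1 ((k + 1 : ℕ) : ℤ) (by positivity)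
  rw [Int.cast_natCast] at e
  obtain ⟨h', hk⟩ := hclass k
  refine ⟨D.d_pow_succ hm hb ha hdb k, hcyc k, ⟨h', hk⟩, ?_, ⟨e⟩⟩
  refine PadicInt.span_singleton_eq_top_of_smul_ne_zero e fun h0 => ?_
  refine (hord ((k + 1 : ℕ) : ℤ) (by positivity)).1 ?_
  rw [← hk]
  calc D.cls _ h' = -(((k + 1 : ℕ) : ℤ_[p]) • D.cls (a * b ^ k) (hcyc k)) := by
        rw [← neg_smul]; rfl
    _ = 0 := by rw [← neg_zero, ← h0]; rfl
end
end

section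
/- Let D be a commutative dga over ℤ_p such that every element of D_0 is a ℤ_p-multiple of the unit 1_D, and such that H_{-1}(D) is a torsion-free ℤ_p-module (e.g. H_{-1}(D) ≅ ℤ_p). Suppose a ∈ D_{2p-3}, ā ∈ D_{1-2p}, b ∈ D_{2p-2}, b̄ ∈ D_{2-2p} satisfy d(a) = 0, d(ā) = 0, d(b) = p·a and d(b̄) = -p·ā. Then a·b̄ = ā·b in D_{-1}. -/
set_option synthInstance.maxHeartbeats 1000000
set_option maxHeartbeats 1000000

/-!
Statement 14: merging A — a·b̄ = ā·b.
-/

noncomputable section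

namespace DGA

variable {p : ℕ} [Fact p.Prime] (X : DGA p)

theorem comm_of_even {i j : ℤ} (hi : Even i) {a b : X.A} (ha : a ∈ X.grading i)
    (hb : b ∈ X.grading j) : a * b = b * a := by
  simpa [(hi.mul_right j).neg_one_zpow] using X.comm ha hb

theorem comm_of_odd {i j : ℤ} (hi : Odd i) (hj : Odd j) {a b : X.A} (ha : a ∈ X.grading i)
    (hb : b ∈ X.grading j) : a * b = -(b * a) := by
  simpa [(hi.mul hj).neg_one_zpow] using X.comm ha hb

theorem leibniz_of_even_s5 {i : ℤ} (hi : Even i) {a : X.A} (ha : a ∈ X.grading i) (b : X.A) :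
    X.d (a * b) = X.d a * b + a * X.d b := by
  simpa [hi.neg_one_zpow] using X.leibniz ha b

theorem leibniz_of_odd {i : ℤ} (hi : Odd i) {a : X.A} (ha : a ∈ X.grading i) (b : X.A) :
    X.d (a * b) = X.d a * b - a * X.d b := by
  simpa [hi.neg_one_zpow, sub_eq_add_neg] using X.leibniz ha b

theorem d_one : X.d 1 = 0 := by
  simpa using X.leibniz_of_even_s5 Even.zero X.one_mem 1

/-- If `H_n` has no `c`-torsion, then an `n`-cycle killed by `c` is a boundary. -/
theorem mem_boundaries_of_smul_eq_zero {n : ℤ} {c : ℤ_[p]}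
    (hc : ∀ x : X.H n, c • x = 0 → x = 0) {x : X.A} (hx : x ∈ X.cycles n) (h : c • x = 0) :
    x ∈ X.boundaries n := by
  have hcls : X.cls x hx = 0 := by
    apply hc
    have h' : c • (⟨x, hx⟩ : X.cycles n) = 0 := Subtype.ext h
    rw [cls, ← Submodule.Quotient.mk_smul, h', Submodule.Quotient.mk_zero]
  simpa [cls, Submodule.Quotient.mk_eq_zero] using hcls

end DGA

/-- Merging A: if `D_0 = ℤ_p·1`, `H_(-1)(D)` is torsion-free, `d(a) = 0 = d(ā)`,
`d(b) = p·a` and `d(b̄) = -p·ā` (in the indicated degrees), then `a·b̄ = ā·b`. -/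
theorem merging_A (p : ℕ) [Fact p.Prime] (hp : Odd p) (D : DGA p)
    (h0 : ∀ z ∈ D.grading 0, ∃ c : ℤ_[p], z = c • (1 : D.A))
    (htf : ∀ c : ℤ_[p], c ≠ 0 → ∀ x : D.H (-1), c • x = 0 → x = 0)
    (a abar b bbar : D.A)
    (ha : a ∈ D.grading (2 * (p : ℤ) - 3))
    (habar : abar ∈ D.grading (1 - 2 * (p : ℤ)))
    (hb : b ∈ D.grading (2 * (p : ℤ) - 2))
    (hbbar : bbar ∈ D.grading (2 - 2 * (p : ℤ)))
    (hda : D.d a = 0) (hdabar : D.d abar = 0)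
    (hdb : D.d b = (p : ℤ_[p]) • a)
    (hdbbar : D.d bbar = -((p : ℤ_[p]) • abar)) :
    a * bbar = abar * b := by
  have hae : Odd (2 * (p : ℤ) - 3) := ⟨p - 2, by ring⟩
  have habare : Odd (1 - 2 * (p : ℤ)) := ⟨-p, by ring⟩
  have hbe : Even (2 * (p : ℤ) - 2) := ⟨p - 1, by ring⟩
  have hd0 : ∀ z ∈ D.grading 0, D.d z = 0 := by
    intro z hz
    obtain ⟨c, rfl⟩ := h0 z hz
    rw [map_smul, D.d_one, smul_zero]
  have hcomm : b * abar = abar * b := D.comm_of_even hbe hb habar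
  have htors : (p : ℤ_[p]) • (a * bbar - abar * b) = 0 := by
    have hbb : b * bbar ∈ D.grading 0 := by
      convert D.mul_mem hb hbbar using 2
      ring
    have h := hd0 _ hbb
    rw [D.leibniz_of_even_s5 hbe hb, hdb, hdbbar, mul_neg, smul_mul_assoc, mul_smul_comm, hcomm,
      ← sub_eq_add_neg, ← smul_sub] at h
    exact h
  have hdeg : a * bbar - abar * b ∈ D.grading (-1) := by
    apply Submodule.sub_mem
    · convert D.mul_mem ha hbbar using 2
      ring
    · convert D.mul_mem habar hb using 2
      ring
  have hcycle : D.d (a * bbar - abar * b) = 0 := by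
    rw [map_sub, D.leibniz_of_odd hae ha, D.leibniz_of_odd habare habar, hda, hdabar, hdb,
      hdbbar, mul_neg, mul_smul_comm, mul_smul_comm, D.comm_of_odd hae habare ha habar]
    simp
  have hp0 : (p : ℤ_[p]) ≠ 0 := Nat.cast_ne_zero.mpr (Fact.out : p.Prime).ne_zero
  obtain ⟨z, hz, hdz⟩ :=
    D.mem_boundaries_of_smul_eq_zero (htf _ hp0) ⟨hdeg, hcycle⟩ htors
  rw [← sub_eq_zero, ← hdz]
  exact hd0 z hz
end
end

section
/- Let D be a commutative dga over ℤ_p such that every element of D_0 is a ℤ_p-multiple of the unit 1_D. Suppose a ∈ D_{2p-3}, ā ∈ D_{1-2p}, b ∈ D_{2p-2}, b̄ ∈ D_{2-2p} satisfy d(a) = 0, d(ā) = 0, d(b) = p·a, d(b̄) = -p·ā, a·b̄ = ā·b, and b·b̄ = θ·1_D for some θ ∈ ℤ_p. Assume further that the homology class [-a] ∈ H_{2p-3}(D) has annihilator exactly pℤ_p (i.e. [-a] ≠ 0 and p·[-a] = 0), and that the class of ā·b² - 2·a·b·b̄ in H_{2p-3}(D) equals [-a]. Then θ ≡ 1 modulo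 p; in particular θ is a unit of ℤ_p. -/
set_option synthInstance.maxHeartbeats 1000000
set_option maxHeartbeats 1000000

/-!
Statement 15: merging B — θ ≡ 1 mod p, in particular θ is a unit.
-/

noncomputable section

/-- Merging B: with `a·b̄ = ā·b` and `b·b̄ = θ·1`, if the class `[-a] ∈ H_(2p-3)(D)` is
nonzero with `p·[-a] = 0` and the class of `ā·b² - 2·a·b·b̄` equals `[-a]` (the Massey
product relation `⟨α_2, p, α_(-1)⟩ = {α_1}`), then `θ ≡ 1 (mod p)`; in particular `θ`
is a unit of `ℤ_p`. -/
theorem merging_B (p : ℕ) [Fact p.Prime] (hp : Odd p) (D : DGA p)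
    (h0 : ∀ z ∈ D.grading 0, ∃ c : ℤ_[p], z = c • (1 : D.A))
    (a abar b bbar : D.A) (θ : ℤ_[p])
    (ha : a ∈ D.grading (2 * (p : ℤ) - 3))
    (habar : abar ∈ D.grading (1 - 2 * (p : ℤ)))
    (hb : b ∈ D.grading (2 * (p : ℤ) - 2))
    (hbbar : bbar ∈ D.grading (2 - 2 * (p : ℤ)))
    (hda : D.d a = 0) (hdabar : D.d abar = 0)
    (hdb : D.d b = (p : ℤ_[p]) • a)
    (hdbbar : D.d bbar = -((p : ℤ_[p]) • abar))
    (hab : a * bbar = abar * b)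
    (hθ : b * bbar = θ • (1 : D.A))
    (hcyc1 : -a ∈ D.cycles (2 * (p : ℤ) - 3))
    (hne : D.cls (-a) hcyc1 ≠ 0)
    (hpa : (p : ℤ_[p]) • D.cls (-a) hcyc1 = 0)
    (hcyc2 : abar * b ^ 2 - (2 : ℤ_[p]) • (a * b * bbar) ∈ D.cycles (2 * (p : ℤ) - 3))
    (hmassey : D.cls (abar * b ^ 2 - (2 : ℤ_[p]) • (a * b * bbar)) hcyc2
      = D.cls (-a) hcyc1) :
    θ - 1 ∈ Ideal.span {(p : ℤ_[p])} ∧ IsUnit θ := by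
  have hcomm : bbar * b = b * bbar := by
    have h := D.comm hbbar hb
    have he : Even ((2 - 2 * (p : ℤ)) * (2 * (p : ℤ) - 2)) :=
      Even.mul_right (show Even (2 - 2 * (p : ℤ)) from ⟨1 - p, by ring⟩) _
    simpa [he.neg_one_zpow] using h
  have hclass : abar * b ^ 2 - (2 : ℤ_[p]) • (a * b * bbar) = θ • (-a) := by
    have h1 : abar * b ^ 2 = θ • a := by
      rw [pow_two, ← mul_assoc, ← hab, mul_assoc, hcomm, hθ, mul_smul_comm, mul_one]
    have h2 : a * b * bbar = θ • a := by
      rw [mul_assoc, hθ, mul_smul_comm, mul_one]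
    rw [h1, h2]
    module
  have hsmul : (θ - 1) • D.cls (-a) hcyc1 = 0 := by
    have h : D.cls (abar * b ^ 2 - (2 : ℤ_[p]) • (a * b * bbar)) hcyc2
        = θ • D.cls (-a) hcyc1 :=
      congrArg Submodule.Quotient.mk (Subtype.ext hclass)
    rw [sub_smul, one_smul, ← h, hmassey, sub_self]
  have hnonunit : ¬ IsUnit (θ - 1) := fun hu => hne (hu.smul_eq_zero.mp hsmul)
  refine ⟨?_, ?_⟩
  · rw [← PadicInt.maximalIdeal_eq_span_p]
    exact hnonunit
  · by_contra hθu
    have h := IsLocalRing.nonunits_add hθu (b := 1 - θ) fun hu =>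
      hnonunit (by simpa using hu.neg)
    simp at h
end
end
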